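/- arXiv:1205.5302 — 5 statements merged into one kernel-verified Lean document; each statement's English description precedes it below -/
import Mathlib

section
/- Let n ≥ 1, μ > 0, C_f ≥ 0, C_g ≥ 0, 0 < γ < μ, and assume (A1), (A2), (A3). For a bounded continuous function y : (−∞, 0] → ℝ^n define (Sy)(t) := e^{γt}·[ z(t) + ∫_{s=t}^{0} f(t, s, e^{−γs}·y(s)) ds − ∫_{s=−∞}^{0} ∫_{s₁=max(t,s)}^{0} g(t, s₁, s, e^{−γs}·y(s)) ds₁ ds ] for t ≤ 0. Then for any two bounded continuous functions y₁, y₂ : (−∞,0] → ℝ^n and every t ≤ 0: ‖(Sy₁)(t) − (Sy₂)(t)‖ ≤ (C_f/γ)·sup_{t ≤ s ≤ 0} ‖y₁(s) − y₂(s)‖ + (C_g/(γ·(μ − γ)))·sup_{s ≤ 0} ‖y₁(s) − y₂(s)‖. -/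
open MeasureTheory Real Set

theorem integral_exp_neg_mul_Icc_le {c : ℝ} (hc : 0 < c) {a : ℝ} (ha : a ≤ 0) :
    ∫ s in Icc a 0, Real.exp (-c * s) ≤ Real.exp (-c * a) / c := by
  rw [integral_Icc_eq_integral_Ioc, ← intervalIntegral.integral_of_le ha,
    intervalIntegral.integral_comp_mul_left _ (neg_ne_zero.2 hc.ne'), integral_exp, mul_zero,
    Real.exp_zero, smul_eq_mul, inv_neg, neg_mul_comm, neg_sub, inv_mul_eq_div]
  gcongr
  linarith

section Volterra

variable {E : Type*} [NormedAddCommGroup E] [NormedSpace ℝ E]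

theorem continuousOn_exp_smul {γ : ℝ} {y : ℝ → E} (hy : ContinuousOn y (Iic 0)) :
    ContinuousOn (fun s => Real.exp (-γ * s) • y s) (Iic 0) :=
  (by fun_prop : Continuous fun s : ℝ => Real.exp (-γ * s)).continuousOn.smul hy

theorem norm_exp_smul_sub_exp_smul (γ s : ℝ) (x y : E) :
    ‖Real.exp (-γ * s) • x - Real.exp (-γ * s) • y‖ = Real.exp (-γ * s) * ‖x - y‖ := by
  rw [← smul_sub, norm_smul, Real.norm_of_nonneg (Real.exp_pos _).le]

/-- The difference of two Volterra integrals with a Lipschitz kernel, in the exponentially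
weighted norm. -/
theorem norm_volterra_integral_sub_le {L γ M t : ℝ} (hL : 0 ≤ L) (hγ : 0 < γ) (hM : 0 ≤ M)
    (ht : t ≤ 0) {f : ℝ → E → E} (hf : Continuous fun p : ℝ × E => f p.1 p.2)
    (hlip : ∀ s ≤ (0 : ℝ), ∀ x y : E, ‖f s x - f s y‖ ≤ L * ‖x - y‖)
    {y₁ y₂ : ℝ → E} (hy₁ : ContinuousOn y₁ (Iic 0)) (hy₂ : ContinuousOn y₂ (Iic 0))
    (hM' : ∀ s ∈ Icc t 0, ‖y₁ s - y₂ s‖ ≤ M) :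
    ‖(∫ s in Icc t 0, f s (Real.exp (-γ * s) • y₁ s))
      - ∫ s in Icc t 0, f s (Real.exp (-γ * s) • y₂ s)‖ ≤ L / γ * M * Real.exp (-γ * t) := by
  have hint : ∀ y : ℝ → E, ContinuousOn y (Iic 0) →
      IntegrableOn (fun s => f s (Real.exp (-γ * s) • y s)) (Icc t 0) := fun y hy =>
    (hf.comp_continuousOn (continuousOn_id.prodMk
      ((continuousOn_exp_smul hy).mono Icc_subset_Iic_self))).integrableOn_compact isCompact_Icc
  rw [← integral_sub (hint _ hy₁) (hint _ hy₂)]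
  calc _ ≤ ∫ s in Icc t 0, L * M * Real.exp (-γ * s) := by
        refine norm_integral_le_of_norm_le ?_ ?_
        · exact (by fun_prop : Continuous fun s : ℝ => L * M * Real.exp (-γ * s)).integrableOn_Icc
        · filter_upwards [ae_restrict_mem measurableSet_Icc] with s hs
          refine (hlip s hs.2 _ _).trans ?_
          rw [norm_exp_smul_sub_exp_smul, mul_assoc, mul_comm M]
          gcongr
          exact hM' s hs
    _ ≤ L * M * (Real.exp (-γ * t) / γ) := by
        rw [integral_const_mul]
        gcongr
        exact integral_exp_neg_mul_Icc_le hγ ht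
    _ = _ := by ring

/-- The domain of integration of the infinite-delay double integral. -/
def delayDomain (t : ℝ) : Set (ℝ × ℝ) := {p | p.2 ≤ 0 ∧ max t p.2 ≤ p.1 ∧ p.1 ≤ 0}

theorem isClosed_delayDomain (t : ℝ) : IsClosed (delayDomain t) :=
  (isClosed_le continuous_snd continuous_const).inter
    ((isClosed_le (continuous_const.max continuous_snd) continuous_fst).inter
      (isClosed_le continuous_fst continuous_const))

theorem integrableOn_exp_delayDomain {μ γ : ℝ} (hγ : γ < μ) (t : ℝ) :
    IntegrableOn (fun p : ℝ × ℝ => Real.exp (-μ * (p.1 - p.2)) * Real.exp (-γ * p.2))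
      (delayDomain t) := by
  have h₁ : IntegrableOn (fun s : ℝ => Real.exp (-μ * s)) (Icc t 0) :=
    (by fun_prop : Continuous fun s : ℝ => Real.exp (-μ * s)).integrableOn_Icc
  have h₂ : IntegrableOn (fun s : ℝ => Real.exp ((μ - γ) * s)) (Iic 0) :=
    integrableOn_exp_mul_Iic (sub_pos.2 hγ) 0
  have h := h₁.integrable.mul_prod h₂.integrable
  rw [Measure.prod_restrict] at h
  have hsub : delayDomain t ⊆ Icc t 0 ×ˢ Iic 0 := fun p hp =>
    ⟨⟨(le_max_left _ _).trans hp.2.1, hp.2.2⟩, hp.1⟩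
  refine (IntegrableOn.mono_set h hsub).congr_fun (fun p _ => ?_)
    (isClosed_delayDomain t).measurableSet
  simp only [← Real.exp_add]
  ring_nf

variable {L μ γ M t : ℝ} {g : ℝ → ℝ → E → E}

theorem integrableOn_delayDomain (hγ : γ < μ) (hL : 0 ≤ L)
    (hg : Continuous fun p : ℝ × ℝ × E => g p.1 p.2.1 p.2.2)
    (hlip : ∀ s ≤ (0 : ℝ), ∀ s₁, max t s ≤ s₁ → s₁ ≤ 0 → ∀ x y : E,
      ‖g s₁ s x - g s₁ s y‖ ≤ L * Real.exp (-μ * (s₁ - s)) * ‖x - y‖)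
    (hg0 : IntegrableOn (fun p : ℝ × ℝ => ‖g p.1 p.2 0‖) (delayDomain t))
    {y : ℝ → E} (hy : ContinuousOn y (Iic 0)) (hyb : ∃ C : ℝ, ∀ s ≤ (0 : ℝ), ‖y s‖ ≤ C) :
    IntegrableOn (fun p : ℝ × ℝ => g p.1 p.2 (Real.exp (-γ * p.2) • y p.2))
      (delayDomain t) := by
  obtain ⟨C, hC⟩ := hyb
  have hD := isClosed_delayDomain t
  have hcont : ContinuousOn (fun p : ℝ × ℝ => g p.1 p.2 (Real.exp (-γ * p.2) • y p.2))
      (delayDomain t) :=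
    hg.comp_continuousOn (continuousOn_fst.prodMk (continuousOn_snd.prodMk
      ((continuousOn_exp_smul hy).comp continuousOn_snd fun p hp => hp.1)))
  refine Integrable.mono'
    (hg0.integrable.add ((integrableOn_exp_delayDomain hγ t).integrable.const_mul (L * C)))
    (hcont.aestronglyMeasurable hD.measurableSet) ?_
  filter_upwards [ae_restrict_mem hD.measurableSet] with p hp
  have h := hlip p.2 hp.1 p.1 hp.2.1 hp.2.2 (Real.exp (-γ * p.2) • y p.2) 0
  rw [sub_zero, norm_smul, Real.norm_of_nonneg (Real.exp_pos _).le] at h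
  have h' : L * Real.exp (-μ * (p.1 - p.2)) * (Real.exp (-γ * p.2) * ‖y p.2‖) ≤
      L * C * (Real.exp (-μ * (p.1 - p.2)) * Real.exp (-γ * p.2)) := by
    calc _ ≤ L * Real.exp (-μ * (p.1 - p.2)) * (Real.exp (-γ * p.2) * C) := by
          gcongr
          exact hC _ hp.1
      _ = _ := by ring
  have h'' := norm_le_norm_add_norm_sub' (g p.1 p.2 (Real.exp (-γ * p.2) • y p.2)) (g p.1 p.2 0)
  simp only [Pi.add_apply]
  linarith

theorem integrableOn_Iic_integral_of_delayDomain {F : ℝ × ℝ → E}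
    (hF : IntegrableOn F (delayDomain t)) :
    IntegrableOn (fun s => ∫ s₁ in Icc (max t s) 0, F (s₁, s)) (Iic 0) := by
  have hD := (isClosed_delayDomain t).measurableSet
  have h := ((integrable_indicator_iff hD).2 hF).integral_prod_right
  refine (h.integrableOn (s := Iic 0)).congr_fun (fun s hs => ?_) measurableSet_Iic
  simp only
  rw [← integral_indicator measurableSet_Icc]
  refine integral_congr_ae (.of_forall fun s₁ => ?_)
  by_cases hs₁ : s₁ ∈ Icc (max t s) 0
  · have : (s₁, s) ∈ delayDomain t := ⟨hs, hs₁⟩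
    simp only [indicator_of_mem hs₁, indicator_of_mem this]
  · have : (s₁, s) ∉ delayDomain t := fun h => hs₁ h.2
    simp only [indicator_of_notMem hs₁, indicator_of_notMem this]

theorem norm_inner_delay_integral_sub_le (hμ : 0 < μ) (hL : 0 ≤ L) (hM : 0 ≤ M) (ht : t ≤ 0)
    (hg : Continuous fun p : ℝ × ℝ × E => g p.1 p.2.1 p.2.2)
    (hlip : ∀ s ≤ (0 : ℝ), ∀ s₁, max t s ≤ s₁ → s₁ ≤ 0 → ∀ x y : E,
      ‖g s₁ s x - g s₁ s y‖ ≤ L * Real.exp (-μ * (s₁ - s)) * ‖x - y‖)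
    {y₁ y₂ : ℝ → E} {s : ℝ} (hs : s ≤ 0) (hM' : ‖y₁ s - y₂ s‖ ≤ M) :
    ‖(∫ s₁ in Icc (max t s) 0, g s₁ s (Real.exp (-γ * s) • y₁ s))
      - ∫ s₁ in Icc (max t s) 0, g s₁ s (Real.exp (-γ * s) • y₂ s)‖ ≤
      L * M / μ * (Real.exp ((μ - γ) * s) * Real.exp (-μ * max t s)) := by
  have hint : ∀ x : E, IntegrableOn (fun s₁ => g s₁ s x) (Icc (max t s) 0) := fun x =>
    (hg.comp (by fun_prop : Continuous fun s₁ : ℝ => (s₁, s, x))).integrableOn_Icc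
  rw [← integral_sub (hint _) (hint _)]
  calc _ ≤ ∫ s₁ in Icc (max t s) 0, L * M * Real.exp ((μ - γ) * s) * Real.exp (-μ * s₁) := by
        refine norm_integral_le_of_norm_le ?_ ?_
        · exact (by fun_prop : Continuous fun s₁ : ℝ =>
            L * M * Real.exp ((μ - γ) * s) * Real.exp (-μ * s₁)).integrableOn_Icc
        · filter_upwards [ae_restrict_mem measurableSet_Icc] with s₁ hs₁
          refine (hlip s hs s₁ hs₁.1 hs₁.2 _ _).trans ?_
          rw [norm_exp_smul_sub_exp_smul]
          calc _ ≤ L * Real.exp (-μ * (s₁ - s)) * (Real.exp (-γ * s) * M) := by gcongr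
            _ = L * M * (Real.exp (-μ * (s₁ - s)) * Real.exp (-γ * s)) := by ring
            _ = L * M * (Real.exp ((μ - γ) * s) * Real.exp (-μ * s₁)) := by
                simp only [← Real.exp_add]
                ring_nf
            _ = _ := by ring
    _ ≤ L * M * Real.exp ((μ - γ) * s) * (Real.exp (-μ * max t s) / μ) := by
        rw [integral_const_mul]
        gcongr
        exact integral_exp_neg_mul_Icc_le hμ (max_le ht hs)
    _ = _ := by ring

/-- The difference of two infinite-delay double integrals with an exponentially fading Lipschitz
kernel, in the exponentially weighted norm. -/
theorem norm_delay_integral_sub_le (hγ0 : 0 < γ) (hγ : γ < μ) (hL : 0 ≤ L) (hM : 0 ≤ M)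
    (ht : t ≤ 0) (hg : Continuous fun p : ℝ × ℝ × E => g p.1 p.2.1 p.2.2)
    (hlip : ∀ s ≤ (0 : ℝ), ∀ s₁, max t s ≤ s₁ → s₁ ≤ 0 → ∀ x y : E,
      ‖g s₁ s x - g s₁ s y‖ ≤ L * Real.exp (-μ * (s₁ - s)) * ‖x - y‖)
    (hg0 : IntegrableOn (fun p : ℝ × ℝ => ‖g p.1 p.2 0‖) (delayDomain t))
    {y₁ y₂ : ℝ → E} (hy₁ : ContinuousOn y₁ (Iic 0)) (hy₂ : ContinuousOn y₂ (Iic 0))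
    (hb₁ : ∃ C : ℝ, ∀ s ≤ (0 : ℝ), ‖y₁ s‖ ≤ C) (hb₂ : ∃ C : ℝ, ∀ s ≤ (0 : ℝ), ‖y₂ s‖ ≤ C)
    (hM' : ∀ s ≤ 0, ‖y₁ s - y₂ s‖ ≤ M) :
    ‖(∫ s in Iic (0 : ℝ), ∫ s₁ in Icc (max t s) 0, g s₁ s (Real.exp (-γ * s) • y₁ s))
      - ∫ s in Iic (0 : ℝ), ∫ s₁ in Icc (max t s) 0, g s₁ s (Real.exp (-γ * s) • y₂ s)‖ ≤
      L / (γ * (μ - γ)) * M * Real.exp (-γ * t) := by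
  have hμ : 0 < μ := hγ0.trans hγ
  have hμγ : 0 < μ - γ := sub_pos.2 hγ
  have hI₁ := integrableOn_Iic_integral_of_delayDomain
    (integrableOn_delayDomain hγ hL hg hlip hg0 hy₁ hb₁)
  have hI₂ := integrableOn_Iic_integral_of_delayDomain
    (integrableOn_delayDomain hγ hL hg hlip hg0 hy₂ hb₂)
  have hI : IntegrableOn (fun s => (∫ s₁ in Icc (max t s) 0, g s₁ s (Real.exp (-γ * s) • y₁ s))
      - ∫ s₁ in Icc (max t s) 0, g s₁ s (Real.exp (-γ * s) • y₂ s)) (Iic 0) := hI₁.sub hI₂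
  have hinner := fun (s : ℝ) (hs : s ≤ 0) =>
    norm_inner_delay_integral_sub_le (γ := γ) hμ hL hM ht hg hlip hs (hM' s hs)
  rw [← integral_sub hI₁ hI₂, ← Iic_union_Ioc_eq_Iic ht,
    setIntegral_union (Iic_disjoint_Ioc le_rfl) measurableSet_Ioc
      (hI.mono_set (Iic_subset_Iic.2 ht)) (hI.mono_set Ioc_subset_Iic_self)]
  have hK : 0 ≤ L * M / μ := by positivity
  have hfar : ‖∫ s in Iic t, ((∫ s₁ in Icc (max t s) 0, g s₁ s (Real.exp (-γ * s) • y₁ s))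
      - ∫ s₁ in Icc (max t s) 0, g s₁ s (Real.exp (-γ * s) • y₂ s))‖ ≤
      L * M / μ * (Real.exp (-γ * t) / (μ - γ)) := by
    calc _ ≤ ∫ s in Iic t, L * M / μ * Real.exp (-μ * t) * Real.exp ((μ - γ) * s) := by
          refine norm_integral_le_of_norm_le
            ((integrableOn_exp_mul_Iic hμγ t).integrable.const_mul _) ?_
          filter_upwards [ae_restrict_mem measurableSet_Iic] with s hs
          refine (hinner s (le_trans hs ht)).trans_eq ?_
          rw [max_eq_left hs]
          ring
      _ = L * M / μ * (Real.exp (-μ * t) * Real.exp ((μ - γ) * t) / (μ - γ)) := by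
          rw [integral_const_mul, integral_exp_mul_Iic hμγ]
          ring
      _ = _ := by
          rw [← Real.exp_add]
          ring_nf
  have hnear : ‖∫ s in Ioc t 0, ((∫ s₁ in Icc (max t s) 0, g s₁ s (Real.exp (-γ * s) • y₁ s))
      - ∫ s₁ in Icc (max t s) 0, g s₁ s (Real.exp (-γ * s) • y₂ s))‖ ≤
      L * M / μ * (Real.exp (-γ * t) / γ) := by
    calc _ ≤ ∫ s in Ioc t 0, L * M / μ * Real.exp (-γ * s) := by
          refine norm_integral_le_of_norm_le (by fun_prop : Continuous fun s : ℝ =>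
            L * M / μ * Real.exp (-γ * s)).integrableOn_Ioc ?_
          filter_upwards [ae_restrict_mem measurableSet_Ioc] with s hs
          refine (hinner s hs.2).trans_eq ?_
          rw [max_eq_right hs.1.le, ← Real.exp_add]
          ring_nf
      _ ≤ _ := by
          rw [integral_const_mul, ← integral_Icc_eq_integral_Ioc]
          gcongr
          exact integral_exp_neg_mul_Icc_le hγ0 ht
  refine (norm_add_le _ _).trans ((add_le_add hfar hnear).trans_eq ?_)
  field_simp
  ring

end Volterra

/-- The contraction estimate (I.7) in the proof of Theorem I.1:
`‖(Sy₁)(t) − (Sy₂)(t)‖ ≤ (C_f/γ)·sup_{t ≤ s ≤ 0}‖y₁(s) − y₂(s)‖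
   + (C_g/(γ(μ−γ)))·sup_{s ≤ 0}‖y₁(s) − y₂(s)‖` for every `t ≤ 0`. -/
theorem contraction_estimate
    (n : ℕ) (hn : 1 ≤ n) (μ Cf Cg γ : ℝ) (hμ : 0 < μ) (hCf : 0 ≤ Cf) (hCg : 0 ≤ Cg)
    (hγ0 : 0 < γ) (hγμ : γ < μ)
    (f : ℝ → ℝ → EuclideanSpace ℝ (Fin n) → EuclideanSpace ℝ (Fin n))
    (g : ℝ → ℝ → ℝ → EuclideanSpace ℝ (Fin n) → EuclideanSpace ℝ (Fin n))
    (z : ℝ → EuclideanSpace ℝ (Fin n))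
    -- (A1)
    (hf_cont : Continuous fun p : ℝ × ℝ × EuclideanSpace ℝ (Fin n) => f p.1 p.2.1 p.2.2)
    (hg_cont : Continuous fun p : ℝ × ℝ × ℝ × EuclideanSpace ℝ (Fin n) =>
      g p.1 p.2.1 p.2.2.1 p.2.2.2)
    (hf_lip : ∀ t ≤ (0:ℝ), ∀ s ≤ (0:ℝ), ∀ x y : EuclideanSpace ℝ (Fin n),
      ‖f t s x - f t s y‖ ≤ Cf * ‖x - y‖)
    (hg_lip : ∀ t ≤ (0:ℝ), ∀ s ≤ (0:ℝ), ∀ s₁, max t s ≤ s₁ → s₁ ≤ 0 →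
      ∀ x y : EuclideanSpace ℝ (Fin n),
      ‖g t s₁ s x - g t s₁ s y‖ ≤ Cg * Real.exp (-μ * (s₁ - s)) * ‖x - y‖)
    -- (A2)
    (hg_int : ∀ t ≤ (0:ℝ), IntegrableOn (fun p : ℝ × ℝ => ‖g t p.1 p.2 0‖)
      {p : ℝ × ℝ | p.2 ≤ 0 ∧ max t p.2 ≤ p.1 ∧ p.1 ≤ 0})
    -- (A3)
    (hz_cont : Continuous z)
    (hz_bdd : ∃ C : ℝ, ∀ t ≤ (0:ℝ), ‖z t‖ ≤ C)
    -- the two bounded continuous functions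
    (y₁ y₂ : ℝ → EuclideanSpace ℝ (Fin n))
    (hy₁_cont : ContinuousOn y₁ (Iic 0)) (hy₂_cont : ContinuousOn y₂ (Iic 0))
    (hy₁_bdd : ∃ C : ℝ, ∀ t ≤ (0:ℝ), ‖y₁ t‖ ≤ C)
    (hy₂_bdd : ∃ C : ℝ, ∀ t ≤ (0:ℝ), ‖y₂ t‖ ≤ C)
    -- the operator S
    (S : (ℝ → EuclideanSpace ℝ (Fin n)) → ℝ → EuclideanSpace ℝ (Fin n))
    (hS : ∀ y : ℝ → EuclideanSpace ℝ (Fin n), ∀ t : ℝ,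
      S y t = Real.exp (γ * t) •
        (z t + (∫ s in Icc t 0, f t s (Real.exp (-γ * s) • y s))
          - ∫ s in Iic (0:ℝ), ∫ s₁ in Icc (max t s) 0,
              g t s₁ s (Real.exp (-γ * s) • y s))) :
    ∀ t ≤ (0:ℝ),
      ‖S y₁ t - S y₂ t‖ ≤
        (Cf / γ) * (⨆ s : Icc t (0:ℝ), ‖y₁ (s : ℝ) - y₂ (s : ℝ)‖)
        + (Cg / (γ * (μ - γ))) * (⨆ s : Iic (0:ℝ), ‖y₁ (s : ℝ) - y₂ (s : ℝ)‖) := by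

  intro t ht
  obtain ⟨C₁, hC₁⟩ := hy₁_bdd
  obtain ⟨C₂, hC₂⟩ := hy₂_bdd
  have hsub : ∀ s ≤ (0 : ℝ), ‖y₁ s - y₂ s‖ ≤ C₁ + C₂ := fun s hs =>
    (norm_sub_le _ _).trans (add_le_add (hC₁ s hs) (hC₂ s hs))
  have hb₁ : BddAbove (range fun s : Icc t (0 : ℝ) => ‖y₁ (s : ℝ) - y₂ (s : ℝ)‖) :=
    ⟨C₁ + C₂, by rintro _ ⟨s, rfl⟩; exact hsub s s.2.2⟩
  have hb₂ : BddAbove (range fun s : Iic (0 : ℝ) => ‖y₁ (s : ℝ) - y₂ (s : ℝ)‖) :=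
    ⟨C₁ + C₂, by rintro _ ⟨s, rfl⟩; exact hsub s s.2⟩
  have hV := norm_volterra_integral_sub_le hCf hγ0 (Real.iSup_nonneg fun _ => norm_nonneg _) ht
    (hf_cont.comp (Continuous.prodMk_right t)) (hf_lip t ht) hy₁_cont hy₂_cont
    fun s hs => le_ciSup hb₁ ⟨s, hs⟩
  have hD := norm_delay_integral_sub_le hγ0 hγμ hCg (Real.iSup_nonneg fun _ => norm_nonneg _) ht
    (hg_cont.comp (Continuous.prodMk_right t)) (hg_lip t ht) (hg_int t ht) hy₁_cont hy₂_cont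
    ⟨C₁, hC₁⟩ ⟨C₂, hC₂⟩ fun s hs => le_ciSup hb₂ ⟨s, hs⟩
  have hexp : Real.exp (γ * t) * Real.exp (-γ * t) = 1 := by
    rw [← Real.exp_add, neg_mul, add_neg_cancel, Real.exp_zero]
  rw [hS, hS, ← smul_sub, norm_smul, Real.norm_of_nonneg (Real.exp_pos _).le, sub_sub_sub_comm,
    add_sub_add_left_eq_sub]
  refine (mul_le_mul_of_nonneg_left ((norm_sub_le _ _).trans (add_le_add hV hD))
    (Real.exp_pos _).le).trans_eq ?_
  rw [← add_mul, mul_comm, mul_assoc, mul_comm (Real.exp (-γ * t)), hexp, mul_one]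
end

section
/- Let C₀, C₁, C₂ be complex numbers with Re(C₂) ≠ 0 and Im(C₂) ≠ 0. Define Q₁ := (Re(C₂)·Im(C₀) − Im(C₂)·Re(C₀))² − (Re(C₂)·Im(C₁) − Im(C₂)·Re(C₁))·(Re(C₁)·Im(C₀) − Im(C₁)·Re(C₀)) and Q₂ := (Re(C₁))² − 4·Re(C₀)·Re(C₂). Then the equation C₂·x² + C₁·x + C₀ = 0 has at least one real root x ∈ ℝ if and only if Q₂ ≥ 0 and Q₁ = 0. -/
/-- A real quadratic and a real polynomial of degree at most two have a common real root iff the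
quadratic has nonnegative discriminant and their resultant vanishes. -/
theorem exists_common_root_iff {a b c d e f : ℝ} (ha : a ≠ 0) :
    (∃ x : ℝ, a * x ^ 2 + b * x + c = 0 ∧ d * x ^ 2 + e * x + f = 0) ↔
      (b ^ 2 - 4 * c * a ≥ 0 ∧
        (a * f - d * c) ^ 2 - (a * e - d * b) * (b * f - e * c) = 0) := by
  constructor
  · rintro ⟨x, h₁, h₂⟩
    obtain rfl : c = -(a * x ^ 2 + b * x) := by linarith
    obtain rfl : f = -(d * x ^ 2 + e * x) := by linarith
    exact ⟨by nlinarith [sq_nonneg (2 * a * x + b)], by ring⟩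
  · rintro ⟨hdisc, hres⟩
    by_cases hq : a * e - d * b = 0
    · have hp : a * f - d * c = 0 := by
        rw [hq, zero_mul, sub_zero] at hres
        exact pow_eq_zero_iff two_ne_zero |>.mp hres
      obtain ⟨x, hx⟩ : ∃ x, a * (x * x) + b * x + c = 0 := by
        refine exists_quadratic_eq_zero ha ⟨√(b ^ 2 - 4 * c * a), ?_⟩
        rw [Real.mul_self_sqrt hdisc, discrim]
        ring
      refine ⟨x, by linarith, mul_left_cancel₀ ha ?_⟩
      linear_combination d * hx + x * hq + hp
    · refine ⟨-(a * f - d * c) / (a * e - d * b), ?_, ?_⟩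
      · field_simp
        linear_combination a * hres
      · field_simp
        linear_combination d * hres

/-- Elimination criterion (5.12): for complex coefficients `C₀, C₁, C₂` with
`Re C₂ ≠ 0` and `Im C₂ ≠ 0`, the quadratic `C₂x² + C₁x + C₀ = 0` has a real root
iff `Q₂ ≥ 0` and `Q₁ = 0`. -/
theorem quadratic_real_root_criterion (C₀ C₁ C₂ : ℂ)
    (h2re : C₂.re ≠ 0) (h2im : C₂.im ≠ 0) :
    (∃ x : ℝ, C₂ * (x : ℂ) ^ 2 + C₁ * (x : ℂ) + C₀ = 0) ↔
      ((C₁.re) ^ 2 - 4 * C₀.re * C₂.re ≥ 0 ∧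
        (C₂.re * C₀.im - C₂.im * C₀.re) ^ 2
          - (C₂.re * C₁.im - C₂.im * C₁.re) * (C₁.re * C₀.im - C₁.im * C₀.re) = 0) := by
  rw [← exists_common_root_iff h2re]
  refine exists_congr fun x => ?_
  rw [Complex.ext_iff, ← Complex.ofReal_pow]
  simp only [Complex.add_re, Complex.add_im, Complex.re_mul_ofReal, Complex.im_mul_ofReal,
    Complex.zero_re, Complex.zero_im]
end

section
/- Let T > 0, ϑ := 2π/T, a₀, a₁ ∈ ℝ, μ > 0, C ≥ 0, and let ω ∈ ℝ satisfy n·ϑ + ω ≠ 0 for every integer n. Let K : ℝ×ℝ → ℝ be continuous with |K(t,s)| ≤ C·exp(−μ·(t − s)) for all s ≤ t. For integers n, m define S_{nm} := −(1/(i·n·ϑ + i·ω)²)·( K_{nm}(ϑ, iω) − a₀·δ_{nm} − (a₁/2)·δ_{n−1,m} − (a₁/2)·δ_{n+1,m} ). Then ∑_{n ∈ ℤ} sup_{m ∈ ℤ} |S_{nm}| < ∞. -/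
open MeasureTheory Set ENNReal

/-- The Fourier coefficients `K_{nm}(ϑ,γ)` of the kernel, with `ϑ = 2π/T`. -/
noncomputable def Kcoef (T : ℝ) (K : ℝ → ℝ → ℝ) (γ : ℂ) (n m : ℤ) : ℂ :=
  (1 / (T : ℂ)) * ∫ t in Icc (0:ℝ) T, ∫ s in Iic t,
    (K t s : ℂ) * Complex.exp (Complex.I * ((2 * Real.pi / T : ℝ) : ℂ)
        * ((m : ℂ) * (s : ℂ) - (n : ℂ) * (t : ℂ))
      + γ * ((s : ℂ) - (t : ℂ)))

/-- An exponentially decaying kernel has Fourier coefficients bounded by `C / μ`. -/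
theorem norm_Kcoef_le {T : ℝ} (hT : 0 < T) {μ C : ℝ} (hμ : 0 < μ) {K : ℝ → ℝ → ℝ}
    (hK : ∀ s t : ℝ, s ≤ t → |K t s| ≤ C * Real.exp (-μ * (t - s))) (ω : ℝ) (n m : ℤ) :
    ‖Kcoef T K ((ω : ℂ) * Complex.I) n m‖ ≤ C / μ := by
  have inner : ∀ t : ℝ, ‖∫ s in Iic t,
      (K t s : ℂ) * Complex.exp (Complex.I * ((2 * Real.pi / T : ℝ) : ℂ)
        * ((m : ℂ) * (s : ℂ) - (n : ℂ) * (t : ℂ))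
      + (ω : ℂ) * Complex.I * ((s : ℂ) - (t : ℂ)))‖ ≤ C / μ := by
    intro t
    have hint : ∫ s in Iic t, C * Real.exp (-μ * t) * Real.exp (μ * s) = C / μ := by
      rw [integral_const_mul, integral_exp_mul_Iic hμ, mul_div_assoc', mul_assoc, ← Real.exp_add]
      simp
    rw [← hint]
    refine norm_integral_le_of_norm_le ((integrableOn_exp_mul_Iic hμ t).const_mul _) ?_
    refine ae_restrict_of_forall_mem measurableSet_Iic fun s hs => ?_
    have hphase : Complex.I * ((2 * Real.pi / T : ℝ) : ℂ)
        * ((m : ℂ) * (s : ℂ) - (n : ℂ) * (t : ℂ)) + (ω : ℂ) * Complex.I * ((s : ℂ) - (t : ℂ))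
        = ((2 * Real.pi / T * (m * s - n * t) + ω * (s - t) : ℝ) : ℂ) * Complex.I := by
      push_cast
      ring
    rw [hphase, norm_mul, Complex.norm_exp_ofReal_mul_I, mul_one, Complex.norm_real,
      Real.norm_eq_abs, mul_assoc, ← Real.exp_add]
    convert hK s t hs using 3
    ring
  have outer := norm_setIntegral_le_of_norm_le_const (μ := volume) (s := Icc (0 : ℝ) T)
    measure_Icc_lt_top fun t _ => inner t
  rw [Real.volume_real_Icc_of_le hT.le, sub_zero] at outer
  rw [Kcoef, norm_mul, norm_div, norm_one, Complex.norm_real, Real.norm_of_nonneg hT.le]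
  calc _ ≤ 1 / T * (C / μ * T) := by gcongr
    _ = C / μ := by field_simp

/-- The inverse squares of a nondegenerate shifted lattice are summable. -/
theorem summable_inv_sq_int_mul_add {a : ℝ} (ha : a ≠ 0) (b : ℝ) :
    Summable fun n : ℤ => (((n : ℝ) * a + b) ^ 2)⁻¹ := by
  have h := ((Real.summable_one_div_int_add_rpow (b / a) 2).2 one_lt_two).mul_left (a ^ 2)⁻¹
  refine h.congr fun n => ?_
  rw [Real.rpow_two, sq_abs, one_div, ← mul_inv, ← mul_pow]
  congr 2
  field_simp

/-- Section 3: for an exponentially decaying kernel, the off-identity part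
`S_{nm} = D_{nm}(ϑ, iω) − δ_{nm}` of the infinite matrix satisfies the
generalized von Koch condition `∑_n sup_m |S_{nm}| < ∞`. -/
theorem von_koch_condition_for_exponential_kernels
    (T : ℝ) (hT : 0 < T) (a₀ a₁ μ C : ℝ) (hμ : 0 < μ) (hC : 0 ≤ C) (ω : ℝ)
    (hres : ∀ n : ℤ, (n : ℝ) * (2 * Real.pi / T) + ω ≠ 0)
    (K : ℝ → ℝ → ℝ) (hK_cont : Continuous fun p : ℝ × ℝ => K p.1 p.2)
    (hK_bound : ∀ s t : ℝ, s ≤ t → |K t s| ≤ C * Real.exp (-μ * (t - s)))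
    (S : ℤ → ℤ → ℂ)
    (hS : ∀ n m : ℤ, S n m =
      -(1 / (Complex.I * (n : ℂ) * ((2 * Real.pi / T : ℝ) : ℂ)
          + Complex.I * (ω : ℂ)) ^ 2) *
        (Kcoef T K ((ω : ℂ) * Complex.I) n m
          - (a₀ : ℂ) * (if n = m then (1:ℂ) else 0)
          - ((a₁ : ℂ) / 2) * (if n - 1 = m then (1:ℂ) else 0)
          - ((a₁ : ℂ) / 2) * (if n + 1 = m then (1:ℂ) else 0))) :
    (∑' n : ℤ, ⨆ m : ℤ, (‖S n m‖₊ : ℝ≥0∞)) < ⊤ := by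
  set ϑ : ℝ := 2 * Real.pi / T
  have hϑ0 : ϑ ≠ 0 := by positivity
  have hite : ∀ (a : ℂ) (p : Prop) [Decidable p], ‖a * (if p then (1 : ℂ) else 0)‖ ≤ ‖a‖ := by
    intro a p _
    split_ifs <;> simp
  set M : ℝ := C / μ + ‖(a₀ : ℂ)‖ + ‖(a₁ : ℂ) / 2‖ + ‖(a₁ : ℂ) / 2‖
  have hbound : ∀ n m : ℤ, ‖S n m‖ ≤ (((n : ℝ) * ϑ + ω) ^ 2)⁻¹ * M := by
    intro n m
    have hden : Complex.I * (n : ℂ) * (ϑ : ℂ) + Complex.I * (ω : ℂ)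
        = Complex.I * (((n : ℝ) * ϑ + ω : ℝ) : ℂ) := by
      push_cast
      ring
    rw [hS, hden, norm_mul, norm_neg, norm_div, norm_one, norm_pow, norm_mul, Complex.norm_I,
      one_mul, Complex.norm_real, Real.norm_eq_abs, sq_abs, one_div]
    gcongr
    exact norm_sub_le_of_le (norm_sub_le_of_le (norm_sub_le_of_le
      (norm_Kcoef_le hT hμ hK_bound ω n m) (hite _ _)) (hite _ _)) (hite _ _)
  have hsum := (summable_inv_sq_int_mul_add hϑ0 ω).mul_right M
  refine lt_of_le_of_lt (ENNReal.tsum_le_tsum fun n => iSup_le fun m => ?_)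
    hsum.tsum_ofReal_lt_top
  rw [← enorm_eq_nnnorm, ← ofReal_norm]
  exact ENNReal.ofReal_le_ofReal (hbound n m)
end

section
/- Let T > 0, ϑ := 2π/T, c ∈ ℝ, μ > 0, and let γ ∈ ℂ with μ + Re(γ) > 0. Then for all integers n, m: (1/T)·∫_{t=0}^{T} ∫_{s=−∞}^{t} c·exp(−μ·(t − s))·exp(i·ϑ·(m·s − n·t) + γ·(s − t)) ds dt = δ_{nm} · c/(μ + γ + i·m·ϑ). -/
open MeasureTheory Set

/-- The average over one period of the `k`-th Fourier mode. -/
theorem average_exp_two_pi_mul_int (T : ℝ) (hT : 0 < T) (k : ℤ) :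
    (1 / (T : ℂ)) * ∫ t in Icc (0:ℝ) T,
        Complex.exp (Complex.I * ((2 * Real.pi / T : ℝ) : ℂ) * (k : ℂ) * (t : ℂ))
      = if k = 0 then 1 else 0 := by
  have hT' : (T : ℂ) ≠ 0 := by exact_mod_cast hT.ne'
  rw [integral_Icc_eq_integral_Ioc, ← intervalIntegral.integral_of_le hT.le]
  split_ifs with hk
  · simp [hk, hT']
  · have hne : Complex.I * ((2 * Real.pi / T : ℝ) : ℂ) * (k : ℂ) ≠ 0 := by
      simp [hk, hT', Real.pi_ne_zero]
    have hperiod : Complex.I * ((2 * Real.pi / T : ℝ) : ℂ) * (k : ℂ) * (T : ℂ)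
        = k * (2 * Real.pi * Complex.I) := by
      push_cast
      field_simp
    rw [integral_exp_mul_complex hne, hperiod, Complex.exp_int_mul_two_pi_mul_I]
    simp

/-- The inner integral of an exponential kernel against Fourier modes. -/
theorem integral_Iic_exponential_kernel (c μ θ : ℝ) (γ : ℂ) (hγ : 0 < μ + γ.re) (n m : ℤ)
    (t : ℝ) :
    ∫ s in Iic t, ((c : ℂ) * Complex.exp (-(μ : ℂ) * ((t : ℂ) - (s : ℂ)))) *
        Complex.exp (Complex.I * (θ : ℂ) * ((m : ℂ) * (s : ℂ) - (n : ℂ) * (t : ℂ))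
          + γ * ((s : ℂ) - (t : ℂ)))
      = (c : ℂ) / ((μ : ℂ) + γ + Complex.I * (m : ℂ) * (θ : ℂ)) *
        Complex.exp (Complex.I * (θ : ℂ) * ((m - n : ℤ) : ℂ) * (t : ℂ)) := by
  have ha : 0 < ((μ : ℂ) + γ + Complex.I * (m : ℂ) * (θ : ℂ)).re := by simpa using hγ
  have hsplit (s : ℝ) : ((c : ℂ) * Complex.exp (-(μ : ℂ) * ((t : ℂ) - (s : ℂ)))) *
      Complex.exp (Complex.I * (θ : ℂ) * ((m : ℂ) * (s : ℂ) - (n : ℂ) * (t : ℂ))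
        + γ * ((s : ℂ) - (t : ℂ)))
      = ((c : ℂ) * Complex.exp (-((μ : ℂ) + γ + Complex.I * (n : ℂ) * (θ : ℂ)) * t)) *
        Complex.exp (((μ : ℂ) + γ + Complex.I * (m : ℂ) * (θ : ℂ)) * s) := by
    rw [mul_assoc, mul_assoc (c : ℂ), ← Complex.exp_add, ← Complex.exp_add]
    ring_nf
  simp_rw [hsplit]
  rw [integral_const_mul, integral_exp_mul_complex_Iic ha, mul_div_assoc', mul_assoc,
    ← Complex.exp_add, div_mul_eq_mul_div]
  push_cast
  ring_nf

/-- Formula (10.4) for a single exponential term: for the kernel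
`K(t,s) = c·exp(−μ(t−s))` and `μ + Re γ > 0`, the Fourier coefficients are
diagonal: `K_{nm}(ϑ,γ) = δ_{nm}·c/(μ + γ + imϑ)`, where `ϑ = 2π/T`. -/
theorem exponential_kernel_fourier_coefficients
    (T : ℝ) (hT : 0 < T) (c μ : ℝ) (hμ : 0 < μ)
    (γ : ℂ) (hγ : 0 < μ + γ.re) :
    ∀ n m : ℤ,
      (1 / (T : ℂ)) * ∫ t in Icc (0:ℝ) T, ∫ s in Iic t,
          ((c : ℂ) * Complex.exp (-(μ : ℂ) * ((t : ℂ) - (s : ℂ)))) *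
            Complex.exp (Complex.I * ((2 * Real.pi / T : ℝ) : ℂ)
                * ((m : ℂ) * (s : ℂ) - (n : ℂ) * (t : ℂ))
              + γ * ((s : ℂ) - (t : ℂ)))
        = (if n = m then (1:ℂ) else 0) *
            ((c : ℂ) / ((μ : ℂ) + γ + Complex.I * (m : ℂ) * ((2 * Real.pi / T : ℝ) : ℂ))) := by
  intro n m
  simp_rw [integral_Iic_exponential_kernel c μ _ γ hγ n m]
  rw [integral_const_mul, mul_left_comm, average_exp_two_pi_mul_int T hT, mul_comm]
  simp only [sub_eq_zero, eq_comm]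
end

section
/- Let N ≥ 1, and let d, p, q : {1, …, 2N} → ℂ be arbitrary. For a ∈ ℂ let M(a) be the 2N×2N complex tridiagonal matrix with diagonal entries M(a)_{kk} = d(k), superdiagonal entries M(a)_{k,k+1} = a/2 − p(k), subdiagonal entries M(a)_{k+1,k} = a/2 − q(k), and all other entries 0. Then there exists a polynomial P over ℂ of degree exactly 2N with leading coefficient (−1)^N/4^N such that det(M(a)) = P(a) for all a ∈ ℂ. -/
open Matrix Polynomial

/-- The tridiagonal matrix with zero diagonal and constant off-diagonal entries `c`. -/
def pathMatrix {R : Type*} [Zero R] (c : R) (n : ℕ) : Matrix (Fin n) (Fin n) R :=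
  Matrix.of fun i j => if (j : ℕ) = i + 1 ∨ (i : ℕ) = j + 1 then c else 0

theorem det_pathMatrix_add_two {R : Type*} [CommRing R] (c : R) (n : ℕ) :
    (pathMatrix c (n + 2)).det = -c ^ 2 * (pathMatrix c n).det := by
  have hrow (j : Fin n) : pathMatrix c (n + 2) 0 j.succ.succ = 0 := by
    simp [pathMatrix]
  have hcol (i : Fin n) : pathMatrix c (n + 2) i.succ.succ 0 = 0 := by
    simp [pathMatrix]
  have hsub : ((pathMatrix c (n + 2)).submatrix Fin.succ (Fin.succAbove 1)).submatrix
      Fin.succ Fin.succ = pathMatrix c n := by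
    ext i j
    simp [pathMatrix, Fin.succAbove, Fin.lt_def]
  have hminor : ((pathMatrix c (n + 2)).submatrix Fin.succ (Fin.succAbove 1)).det
      = c * (pathMatrix c n).det := by
    rw [det_succ_column_zero, Fin.sum_univ_succ, Finset.sum_eq_zero, Fin.succAbove_zero, hsub]
    · simp [pathMatrix]
    · intro i _
      simp [hcol]
  rw [det_succ_row_zero, Fin.sum_univ_succ, Fin.sum_univ_succ, Finset.sum_eq_zero,
    Fin.succ_zero_eq_one, hminor]
  · simp [pathMatrix]
    ring
  · intro j _
    simp [hrow]

theorem det_pathMatrix_two_mul {R : Type*} [CommRing R] (c : R) (N : ℕ) :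
    (pathMatrix c (2 * N)).det = (-c ^ 2) ^ N := by
  induction N with
  | zero => simp
  | succ N ih => rw [Nat.mul_succ, det_pathMatrix_add_two, ih, pow_succ' (-c ^ 2)]

/-- Sections 8 and 10: the determinant of the `2N×2N` tridiagonal matrix with diagonal
`d(k)`, superdiagonal `a/2 − p(k)` and subdiagonal `a/2 − q(k)` is, as a function of `a`,
a polynomial of degree exactly `2N` with leading coefficient `(−1)^N/4^N`. -/
theorem tridiagonal_determinant_leading_term
    (N : ℕ) (hN : 1 ≤ N) (d p q : Fin (2 * N) → ℂ) :
    ∃ P : Polynomial ℂ, P.degree = (2 * N : ℕ) ∧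
      P.leadingCoeff = (-1 : ℂ) ^ N / 4 ^ N ∧
      ∀ a : ℂ, Matrix.det (Matrix.of fun i j : Fin (2 * N) =>
          if i = j then d i
          else if (j : ℕ) = (i : ℕ) + 1 then a / 2 - p i
          else if (i : ℕ) = (j : ℕ) + 1 then a / 2 - q j
          else 0)
        = P.eval a := by
  let A := pathMatrix (1 / 2 : ℂ) (2 * N)
  let B : Matrix (Fin (2 * N)) (Fin (2 * N)) ℂ := Matrix.of fun i j =>
    if i = j then d i
    else if (j : ℕ) = (i : ℕ) + 1 then -p i
    else if (i : ℕ) = (j : ℕ) + 1 then -q j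
    else 0
  let P : ℂ[X] := det ((X : ℂ[X]) • A.map C + B.map C)
  have hcoeff : P.coeff (2 * N) = (-1 : ℂ) ^ N / 4 ^ N := by
    have h := coeff_det_X_add_C_card A B
    rw [Fintype.card_fin, det_pathMatrix_two_mul] at h
    rw [h, ← div_pow]
    norm_num
  have hle : P.natDegree ≤ 2 * N := by
    simpa using natDegree_det_X_add_C_le A B
  have hne : P.coeff (2 * N) ≠ 0 := by
    rw [hcoeff]
    simp
  have hdeg : P.natDegree = 2 * N := natDegree_eq_of_le_of_coeff_ne_zero hle hne
  have hP : P ≠ 0 := fun h => hne (by simp [h])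
  refine ⟨P, by rw [degree_eq_natDegree hP, hdeg], by rw [leadingCoeff, hdeg, hcoeff], fun a => ?_⟩
  rw [← coe_evalRingHom, RingHom.map_det]
  congr 1
  ext i j
  simp only [A, B, pathMatrix, RingHom.mapMatrix_apply, map_apply, Matrix.add_apply,
    Matrix.smul_apply, of_apply, smul_eq_mul, coe_evalRingHom, eval_add, eval_mul, eval_X, eval_C,
    Fin.ext_iff]
  split_ifs <;> first | omega | ring
end
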